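/- arXiv:2605.15960 — 5 statements merged into one kernel-verified Lean document; each statement's English description precedes it below -/
import Mathlib

section
/- On the set of all non-stationary policies, every pair of transition models that is non-trivial and non-equivalent (relative to that set) is exploitable. Precisely: fix a finite task (S, A, d0, R, γ) with γ ∈ [0,1); if T and T' are transition models such that neither of the value functions J_T, J_{T'} is constant on the set of all non-stationary policies, and J_T, J_{T'} do not induce the same ordering on that set, then there exist non-stationary policies π, π' with J_T(π) > J_T(π') and J_{T'}(π') > J_{T'}(π). -/
open Matrix

/-- `p` is a probability distribution on the finite set `S`. -/
def IsDist {S : Type*} [Fintype S] (p : S → ℝ) : Prop :=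
  (∀ s, 0 ≤ p s) ∧ ∑ s, p s = 1

/-- `π` is a stationary policy: each `π s` is a distribution over actions. -/
def IsPolicy {S A : Type*} [Fintype A] (π : S → A → ℝ) : Prop :=
  ∀ s, (∀ a, 0 ≤ π s a) ∧ ∑ a, π s a = 1

/-- `T` is a transition model: each `T s a` is a distribution over next states. -/
def IsTransModel {S A : Type*} [Fintype S] (T : S → A → S → ℝ) : Prop :=
  ∀ s a, (∀ s', 0 ≤ T s a s') ∧ ∑ s', T s a s' = 1

/-- The policy-induced transition matrix `P^π(s,s') = Σ_a π(a|s) T(s'|s,a)`. -/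
noncomputable def Pmat {S A : Type*} [Fintype A] (T : S → A → S → ℝ)
    (π : S → A → ℝ) : Matrix S S ℝ :=
  Matrix.of fun s s' => ∑ a, π s a * T s a s'

/-- The policy-induced expected reward vector `r^π(s) = Σ_a π(a|s) R(s,a)`. -/
noncomputable def rvec {S A : Type*} [Fintype A] (R : S → A → ℝ)
    (π : S → A → ℝ) : S → ℝ :=
  fun s => ∑ a, π s a * R s a

/-- The policy value `J(π) = Σ_s d0(s) V^π(s)` with `V^π = (I - γ P^π)⁻¹ r^π`. -/
noncomputable def Jval {S A : Type*} [Fintype S] [Fintype A] [DecidableEq S]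
    (T : S → A → S → ℝ) (R : S → A → ℝ) (d0 : S → ℝ) (γ : ℝ)
    (π : S → A → ℝ) : ℝ :=
  ∑ s, d0 s * (((1 : Matrix S S ℝ) - γ • Pmat T π)⁻¹ *ᵥ rvec R π) s

/-- Discounted visit counts `F^π(s,a) = μ^π(s) π(a|s)` with
`μ^π = (I - γ (P^π)ᵀ)⁻¹ d0`. -/
noncomputable def visitCount {S A : Type*} [Fintype S] [Fintype A] [DecidableEq S]
    (T : S → A → S → ℝ) (d0 : S → ℝ) (γ : ℝ) (π : S → A → ℝ) :
    S → A → ℝ :=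
  fun s a => ((((1 : Matrix S S ℝ) - γ • (Pmat T π)ᵀ)⁻¹) *ᵥ d0) s * π s a

/-- The policy value written as the inner product `J(π) = ⟨R, F^π⟩`. -/
noncomputable def JvisF {S A : Type*} [Fintype S] [Fintype A] [DecidableEq S]
    (T : S → A → S → ℝ) (R : S → A → ℝ) (d0 : S → ℝ) (γ : ℝ)
    (π : S → A → ℝ) : ℝ :=
  ∑ s, ∑ a, R s a * visitCount T d0 γ π s a

/-- The interior `Π⁺` of the policy space: policies with all entries positive. -/
def PiPlus {S A : Type*} [Fintype A] : Set (S → A → ℝ) :=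
  {π | IsPolicy π ∧ ∀ s a, 0 < π s a}

/-- A non-stationary policy is a sequence of stationary policies. -/
def IsNSPolicy {S A : Type*} [Fintype A] (π : ℕ → S → A → ℝ) : Prop :=
  ∀ t, IsPolicy (π t)

/-- The state distribution at time `t` obtained by propagating `d0` through the
time-inhomogeneous transition matrices induced by the non-stationary policy. -/
noncomputable def stateDist {S A : Type*} [Fintype S] [Fintype A]
    (T : S → A → S → ℝ) (d0 : S → ℝ) (π : ℕ → S → A → ℝ) : ℕ → S → ℝ
  | 0 => d0
  | (t + 1) => fun s' => ∑ s, stateDist T d0 π t s * Pmat T (π t) s s'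

/-- The value of a non-stationary policy:
`J(π) = Σ_{t ≥ 0} γ^t E[R(s_t, a_t)]`. -/
noncomputable def Jns {S A : Type*} [Fintype S] [Fintype A]
    (T : S → A → S → ℝ) (R : S → A → ℝ) (d0 : S → ℝ) (γ : ℝ)
    (π : ℕ → S → A → ℝ) : ℝ :=
  ∑' t : ℕ, γ ^ t * ∑ s, stateDist T d0 π t s * rvec R (π t) s

open Topology

/-- The set of all non-stationary policies. -/
def nsPolicies (S A : Type*) [Fintype A] : Set (ℕ → S → A → ℝ) :=
  {π | IsNSPolicy π}

theorem IsPolicy.lineMap {S A : Type*} [Fintype A] {p q : S → A → ℝ} (hp : IsPolicy p)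
    (hq : IsPolicy q) {a b : ℝ} (ha : 0 ≤ a) (hb : 0 ≤ b) (hab : a + b = 1) :
    IsPolicy (a • p + b • q) := by
  intro s
  refine ⟨fun x => ?_, ?_⟩
  · have h₁ := (hp s).1 x
    have h₂ := (hq s).1 x
    simp only [Pi.add_apply, Pi.smul_apply, smul_eq_mul]
    positivity
  · simp only [Pi.add_apply, Pi.smul_apply, smul_eq_mul, Finset.sum_add_distrib,
      ← Finset.mul_sum, (hp s).2, (hq s).2, mul_one, hab]

theorem convex_nsPolicies (S A : Type*) [Fintype A] : Convex ℝ (nsPolicies S A) :=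
  fun _ hp _ hq _ _ ha hb hab t => (hp t).lineMap (hq t) ha hb hab

theorem IsNSPolicy.update {S A : Type*} [Fintype A] {π : ℕ → S → A → ℝ} (hπ : IsNSPolicy π)
    (k : ℕ) {p : S → A → ℝ} (hp : IsPolicy p) : IsNSPolicy (Function.update π k p) := by
  intro t
  rcases eq_or_ne t k with rfl | h
  · simpa using hp
  · simpa [h] using hπ t

theorem Pmat_lineMap {S A : Type*} [Fintype A] (T : S → A → S → ℝ) (p q : S → A → ℝ)
    (a b : ℝ) (s s' : S) :
    Pmat T (a • p + b • q) s s' = a * Pmat T p s s' + b * Pmat T q s s' := by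
  simp only [Pmat, Matrix.of_apply, Finset.mul_sum, ← Finset.sum_add_distrib, Pi.add_apply,
    Pi.smul_apply, smul_eq_mul]
  exact Finset.sum_congr rfl fun _ _ => by ring

theorem rvec_lineMap {S A : Type*} [Fintype A] (R : S → A → ℝ) (p q : S → A → ℝ)
    (a b : ℝ) (s : S) :
    rvec R (a • p + b • q) s = a * rvec R p s + b * rvec R q s := by
  simp only [rvec, Finset.mul_sum, ← Finset.sum_add_distrib, Pi.add_apply,
    Pi.smul_apply, smul_eq_mul]
  exact Finset.sum_congr rfl fun _ _ => by ring

section Value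

variable {S A : Type*} [Fintype S] [Fintype A] {T : S → A → S → ℝ} {R : S → A → ℝ}
  {d0 : S → ℝ} {γ : ℝ}

theorem isDist_stateDist (hT : IsTransModel T) (hd0 : IsDist d0) {π : ℕ → S → A → ℝ}
    (hπ : IsNSPolicy π) (t : ℕ) : IsDist (stateDist T d0 π t) := by
  induction t with
  | zero => exact hd0
  | succ t ih =>
    refine ⟨fun s' => Finset.sum_nonneg fun s _ => mul_nonneg (ih.1 s) <|
      Finset.sum_nonneg fun a _ => mul_nonneg ((hπ t s).1 a) ((hT s a).1 s'), ?_⟩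
    have hrow : ∀ s, ∑ s', Pmat T (π t) s s' = 1 := by
      intro s
      simp only [Pmat, Matrix.of_apply]
      rw [Finset.sum_comm]
      simp only [← Finset.mul_sum, (hT s _).2, mul_one, (hπ t s).2]
    simp only [stateDist]
    rw [Finset.sum_comm]
    simp only [← Finset.mul_sum, hrow, mul_one, ih.2]

theorem abs_rvec_le (R : S → A → ℝ) {p : S → A → ℝ} (hp : IsPolicy p) (s : S) :
    |rvec R p s| ≤ ∑ s, ∑ a, |R s a| := by
  calc |rvec R p s| ≤ ∑ a, |p s a * R s a| := Finset.abs_sum_le_sum_abs _ _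
    _ ≤ ∑ a, |R s a| := by
        refine Finset.sum_le_sum fun a _ => ?_
        have h1 : p s a ≤ 1 := by
          rw [← (hp s).2]
          exact Finset.single_le_sum (fun b _ => (hp s).1 b) (Finset.mem_univ a)
        rw [abs_mul, abs_of_nonneg ((hp s).1 a)]
        exact mul_le_of_le_one_left (abs_nonneg _) h1
    _ ≤ ∑ s, ∑ a, |R s a| :=
        Finset.single_le_sum (f := fun s => ∑ a, |R s a|)
          (fun s _ => Finset.sum_nonneg fun a _ => abs_nonneg _) (Finset.mem_univ s)

theorem norm_discounted_reward_le (hT : IsTransModel T) (hd0 : IsDist d0) (hγ0 : 0 ≤ γ)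
    {π : ℕ → S → A → ℝ} (hπ : IsNSPolicy π) (t : ℕ) :
    ‖γ ^ t * ∑ s, stateDist T d0 π t s * rvec R (π t) s‖
      ≤ γ ^ t * ∑ s, ∑ a, |R s a| := by
  have hd := isDist_stateDist hT hd0 hπ t
  rw [Real.norm_eq_abs, abs_mul, abs_of_nonneg (pow_nonneg hγ0 t)]
  refine mul_le_mul_of_nonneg_left ?_ (pow_nonneg hγ0 t)
  calc |∑ s, stateDist T d0 π t s * rvec R (π t) s|
      ≤ ∑ s, |stateDist T d0 π t s * rvec R (π t) s| := Finset.abs_sum_le_sum_abs _ _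
    _ ≤ ∑ s, stateDist T d0 π t s * ∑ s, ∑ a, |R s a| := by
        refine Finset.sum_le_sum fun s _ => ?_
        rw [abs_mul, abs_of_nonneg (hd.1 s)]
        exact mul_le_mul_of_nonneg_left (abs_rvec_le R (hπ t) s) (hd.1 s)
    _ = ∑ s, ∑ a, |R s a| := by rw [← Finset.sum_mul, hd.2, one_mul]

theorem summable_geometric_bound (R : S → A → ℝ) (hγ0 : 0 ≤ γ) (hγ1 : γ < 1) :
    Summable fun t : ℕ => γ ^ t * ∑ s, ∑ a, |R s a| :=
  (summable_geometric_of_lt_one hγ0 hγ1).mul_right _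

theorem summable_discounted_reward (hT : IsTransModel T) (hd0 : IsDist d0) (hγ0 : 0 ≤ γ)
    (hγ1 : γ < 1) {π : ℕ → S → A → ℝ} (hπ : IsNSPolicy π) :
    Summable fun t : ℕ => γ ^ t * ∑ s, stateDist T d0 π t s * rvec R (π t) s :=
  Summable.of_norm_bounded (summable_geometric_bound R hγ0 hγ1)
    (norm_discounted_reward_le hT hd0 hγ0 hπ)

theorem continuous_stateDist (T : S → A → S → ℝ) (d0 : S → ℝ) (t : ℕ) (s : S) :
    Continuous fun π : ℕ → S → A → ℝ => stateDist T d0 π t s := by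
  induction t generalizing s with
  | zero => exact continuous_const
  | succ t ih =>
    simp only [stateDist, Pmat, Matrix.of_apply]
    fun_prop

theorem continuousOn_Jns (R : S → A → ℝ) (hT : IsTransModel T) (hd0 : IsDist d0) (hγ0 : 0 ≤ γ)
    (hγ1 : γ < 1) : ContinuousOn (Jns T R d0 γ) (nsPolicies S A) := by
  refine continuousOn_tsum (fun t => Continuous.continuousOn ?_)
    (summable_geometric_bound R hγ0 hγ1)
    fun t π hπ => norm_discounted_reward_le hT hd0 hγ0 hπ t
  have := continuous_stateDist T d0 t
  simp only [rvec]
  fun_prop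

theorem stateDist_update_of_le (T : S → A → S → ℝ) (d0 : S → ℝ) (π : ℕ → S → A → ℝ)
    (p : S → A → ℝ) {k t : ℕ} (h : t ≤ k) :
    stateDist T d0 (Function.update π k p) t = stateDist T d0 π t := by
  induction t with
  | zero => rfl
  | succ t ih =>
    funext s'
    simp only [stateDist, ih (by omega), Function.update_of_ne (show t ≠ k by omega)]

/-- State distributions are affine in the policy used at a single time step. -/
theorem stateDist_update_lineMap (T : S → A → S → ℝ) (d0 : S → ℝ) (π : ℕ → S → A → ℝ) (k : ℕ)
    (p q : S → A → ℝ) {a b : ℝ} (hab : a + b = 1) (t : ℕ) (s : S) :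
    stateDist T d0 (Function.update π k (a • p + b • q)) t s =
      a * stateDist T d0 (Function.update π k p) t s
        + b * stateDist T d0 (Function.update π k q) t s := by
  induction t generalizing s with
  | zero => simp only [stateDist, ← add_mul, hab, one_mul]
  | succ t ih =>
    simp only [stateDist]
    rcases eq_or_ne t k with rfl | h
    · simp only [stateDist_update_of_le T d0 π _ le_rfl, Function.update_self, Pmat_lineMap,
        Finset.mul_sum, ← Finset.sum_add_distrib]
      exact Finset.sum_congr rfl fun _ _ => by ring
    · simp only [ih, Function.update_of_ne h, Finset.mul_sum, ← Finset.sum_add_distrib]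
      exact Finset.sum_congr rfl fun _ _ => by ring

/-- The value is affine in the policy used at a single time step. -/
theorem Jns_update_lineMap (R : S → A → ℝ) (hT : IsTransModel T) (hd0 : IsDist d0) (hγ0 : 0 ≤ γ)
    (hγ1 : γ < 1) {π : ℕ → S → A → ℝ} (hπ : IsNSPolicy π) (k : ℕ) {p q : S → A → ℝ}
    (hp : IsPolicy p) (hq : IsPolicy q) {a b : ℝ} (hab : a + b = 1) :
    Jns T R d0 γ (Function.update π k (a • p + b • q)) =
      a * Jns T R d0 γ (Function.update π k p) + b * Jns T R d0 γ (Function.update π k q) := by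
  have hsp := summable_discounted_reward (R := R) hT hd0 hγ0 hγ1 (hπ.update k hp)
  have hsq := summable_discounted_reward (R := R) hT hd0 hγ0 hγ1 (hπ.update k hq)
  simp only [Jns]
  rw [← tsum_mul_left, ← tsum_mul_left, ← (hsp.mul_left a).tsum_add (hsq.mul_left b)]
  refine tsum_congr fun t => ?_
  rw [mul_left_comm a, mul_left_comm b, ← mul_add]
  congr 1
  rw [Finset.mul_sum, Finset.mul_sum, ← Finset.sum_add_distrib]
  refine Finset.sum_congr rfl fun s _ => ?_
  rcases eq_or_ne t k with rfl | h
  · simp only [stateDist_update_of_le T d0 π _ le_rfl, Function.update_self, rvec_lineMap]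
    ring
  · rw [stateDist_update_lineMap T d0 π k p q hab]
    simp only [Function.update_of_ne h]
    ring

/-- Local constancy of the value is preserved by changing the policy at one time step. -/
theorem eventually_Jns_eq_update (hT : IsTransModel T) (hd0 : IsDist d0) (hγ0 : 0 ≤ γ)
    (hγ1 : γ < 1) {ρ : ℕ → S → A → ℝ} (hρ : IsNSPolicy ρ) {c : ℝ}
    (hc : ∀ᶠ x in 𝓝[nsPolicies S A] ρ, Jns T R d0 γ x = c) (k : ℕ) (p : S → A → ℝ) :
    ∀ᶠ x in 𝓝[nsPolicies S A] (Function.update ρ k p), Jns T R d0 γ x = c := by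
  obtain ⟨U, hU, hρU, hUc⟩ := mem_nhdsWithin.1 hc
  have hV : IsOpen {x : ℕ → S → A → ℝ | Function.update x k (ρ k) ∈ U} :=
    hU.preimage (continuous_id.update k continuous_const)
  refine mem_nhdsWithin.2 ⟨_, hV, by simpa using hρU, ?_⟩
  rintro x ⟨hxU, hx⟩
  have hcont : Continuous fun l : ℝ =>
      Function.update x k ((1 - l) • ρ k + l • x k) :=
    continuous_const.update k (by fun_prop)
  have hnear : ∀ᶠ l in 𝓝[>] (0 : ℝ), Function.update x k ((1 - l) • ρ k + l • x k) ∈ U :=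
    (hcont.continuousAt.eventually (hU.mem_nhds (by simpa using hxU))).filter_mono
      nhdsWithin_le_nhds
  have hlt : ∀ᶠ l in 𝓝[>] (0 : ℝ), l < 1 := nhdsWithin_le_nhds (Iio_mem_nhds one_pos)
  obtain ⟨l, ⟨hlU, hl1⟩, hl0⟩ := ((hnear.and hlt).and self_mem_nhdsWithin).exists
  have hl0 : 0 < l := hl0
  have hx : IsNSPolicy x := hx
  have h0 : Jns T R d0 γ (Function.update x k (ρ k)) = c := hUc ⟨hxU, hx.update k (hρ k)⟩
  have hl : Jns T R d0 γ (Function.update x k ((1 - l) • ρ k + l • x k)) = c :=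
    hUc ⟨hlU, hx.update k ((hρ k).lineMap (hx k) (by linarith) hl0.le (by ring))⟩
  rw [Jns_update_lineMap R hT hd0 hγ0 hγ1 hx k (hρ k) (hx k) (by ring), h0,
    Function.update_eq_self] at hl
  exact mul_left_cancel₀ hl0.ne' (by linarith)

/-- A value function that is locally constant at some non-stationary policy is constant. -/
theorem Jns_eq_of_eventually_eq (hT : IsTransModel T) (hd0 : IsDist d0) (hγ0 : 0 ≤ γ)
    (hγ1 : γ < 1) {ρ : ℕ → S → A → ℝ} (hρ : IsNSPolicy ρ) {c : ℝ}
    (hc : ∀ᶠ x in 𝓝[nsPolicies S A] ρ, Jns T R d0 γ x = c) {σ : ℕ → S → A → ℝ}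
    (hσ : IsNSPolicy σ) : Jns T R d0 γ σ = c := by
  let τ : ℕ → ℕ → S → A → ℝ := fun n t => if t < n then σ t else ρ t
  have hτ : ∀ n, IsNSPolicy (τ n) := by
    intro n t
    by_cases h : t < n
    · simpa [τ, h] using hσ t
    · simpa [τ, h] using hρ t
  have hτc : ∀ n, ∀ᶠ x in 𝓝[nsPolicies S A] (τ n), Jns T R d0 γ x = c := by
    intro n
    induction n with
    | zero => simpa [τ] using hc
    | succ n ih =>
      have hsucc : τ (n + 1) = Function.update (τ n) n (σ n) := by
        funext t
        rcases lt_trichotomy t n with h | rfl | h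
        · simp [τ, h, h.ne, h.trans (Nat.lt_succ_self n)]
        · simp [τ]
        · simp [τ, h.ne', h.not_gt, show ¬ t < n + 1 by omega]
      rw [hsucc]
      exact eventually_Jns_eq_update hT hd0 hγ0 hγ1 (hτ n) ih n (σ n)
  have hlim : Filter.Tendsto τ Filter.atTop (𝓝[nsPolicies S A] σ) := by
    refine tendsto_nhdsWithin_iff.2 ⟨tendsto_pi_nhds.2 fun t => ?_, .of_forall hτ⟩
    refine tendsto_const_nhds.congr' ?_
    filter_upwards [Filter.eventually_gt_atTop t] with n hn
    simp [τ, hn]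
  have hJ := (continuousOn_Jns R hT hd0 hγ0 hγ1 σ hσ).tendsto.comp hlim
  refine tendsto_nhds_unique hJ (tendsto_const_nhds.congr fun n => ?_)
  exact ((hτc n).self_of_nhdsWithin (hτ n)).symm

/-- If two policies tie under a non-trivial `J_T` but not under `J_{T'}`, then `T`, `T'` are
exploitable. -/
theorem exploitable_of_tie {T' : S → A → S → ℝ} (hT : IsTransModel T) (hT' : IsTransModel T')
    (hd0 : IsDist d0) (hγ0 : 0 ≤ γ) (hγ1 : γ < 1)
    (hnt : ∃ π π', IsNSPolicy π ∧ IsNSPolicy π' ∧ Jns T R d0 γ π ≠ Jns T R d0 γ π')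
    {π π' : ℕ → S → A → ℝ} (hπ : IsNSPolicy π) (hπ' : IsNSPolicy π')
    (htie : Jns T R d0 γ π = Jns T R d0 γ π') (hlt : Jns T' R d0 γ π < Jns T' R d0 γ π') :
    ∃ π π', IsNSPolicy π ∧ IsNSPolicy π' ∧
      Jns T R d0 γ π' < Jns T R d0 γ π ∧ Jns T' R d0 γ π < Jns T' R d0 γ π' := by
  by_contra hne
  have hmono : ∀ x y, IsNSPolicy x → IsNSPolicy y → Jns T R d0 γ y < Jns T R d0 γ x →
      Jns T' R d0 γ y ≤ Jns T' R d0 γ x := fun x y hx hy h =>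
    not_lt.1 fun h' => hne ⟨x, y, hx, hy, h, h'⟩
  have hJ := continuousOn_Jns R hT hd0 hγ0 hγ1
  have hJ' := continuousOn_Jns R hT' hd0 hγ0 hγ1
  obtain ⟨ρ, hρ, hsum⟩ := (convex_nsPolicies S A).isPreconnected.intermediate_value hπ hπ'
    (hJ.add hJ') (show Jns T R d0 γ π + (Jns T' R d0 γ π + Jns T' R d0 γ π') / 2 ∈ _ from
      ⟨by simp only [Pi.add_apply]; linarith, by simp only [Pi.add_apply]; linarith⟩)
  simp only [Pi.add_apply] at hsum
  have hρc : Jns T R d0 γ ρ = Jns T R d0 γ π := by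
    rcases lt_trichotomy (Jns T R d0 γ ρ) (Jns T R d0 γ π) with h | h | h
    · linarith [hmono π ρ hπ hρ h]
    · exact h
    · linarith [hmono ρ π' hρ hπ' (htie ▸ h)]
  have hconst : ∀ᶠ x in 𝓝[nsPolicies S A] ρ, Jns T R d0 γ x = Jns T R d0 γ π := by
    filter_upwards [self_mem_nhdsWithin,
      (hJ' ρ hρ).tendsto.eventually_const_lt (show Jns T' R d0 γ π < _ by linarith),
      (hJ' ρ hρ).tendsto.eventually_lt_const (show _ < Jns T' R d0 γ π' by linarith)]
      with x hx h₁ h₂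
    rcases lt_trichotomy (Jns T R d0 γ x) (Jns T R d0 γ π) with h | h | h
    · linarith [hmono π x hπ hx h]
    · exact h
    · linarith [hmono x π' hx hπ' (htie ▸ h)]
  obtain ⟨σ, σ', hσ, hσ', hσne⟩ := hnt
  exact hσne ((Jns_eq_of_eventually_eq hT hd0 hγ0 hγ1 hρ hconst hσ).trans
    (Jns_eq_of_eventually_eq hT hd0 hγ0 hγ1 hρ hconst hσ').symm)

end Value

/-- **No unexploitability on the set of all non-stationary policies**: every
non-trivial, non-equivalent pair of transition models is exploitable there. -/
theorem stmt0 {S A : Type*} [Fintype S] [Fintype A] [Nonempty S]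
    (hA : 1 < Fintype.card A)
    (d0 : S → ℝ) (hd0 : IsDist d0) (R : S → A → ℝ)
    (γ : ℝ) (hγ0 : 0 ≤ γ) (hγ1 : γ < 1)
    (T T' : S → A → S → ℝ) (hT : IsTransModel T) (hT' : IsTransModel T')
    -- `J_T` is non-trivial (non-constant) on the set of non-stationary policies
    (hnt : ∃ π π', IsNSPolicy π ∧ IsNSPolicy π' ∧
      Jns T R d0 γ π ≠ Jns T R d0 γ π')
    -- `J_{T'}` is non-trivial (non-constant) on the set of non-stationary policies
    (hnt' : ∃ π π', IsNSPolicy π ∧ IsNSPolicy π' ∧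
      Jns T' R d0 γ π ≠ Jns T' R d0 γ π')
    -- `J_T` and `J_{T'}` do not induce the same ordering
    (hneq : ¬ ∀ π π', IsNSPolicy π → IsNSPolicy π' →
      (Jns T R d0 γ π' ≤ Jns T R d0 γ π ↔ Jns T' R d0 γ π' ≤ Jns T' R d0 γ π)) :
    ∃ π π', IsNSPolicy π ∧ IsNSPolicy π' ∧
      Jns T R d0 γ π' < Jns T R d0 γ π ∧ Jns T' R d0 γ π < Jns T' R d0 γ π' := by
  push Not at hneq
  obtain ⟨π, π', hπ, hπ', ⟨h, h'⟩ | ⟨h, h'⟩⟩ := hneq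
  · rcases h.lt_or_eq with h | h
    · exact ⟨π, π', hπ, hπ', h, h'⟩
    · exact exploitable_of_tie hT hT' hd0 hγ0 hγ1 hnt hπ hπ' h.symm h'
  · rcases h'.lt_or_eq with h' | h'
    · exact ⟨π', π, hπ', hπ, h, h'⟩
    · obtain ⟨x, y, hx, hy, hxy, hyx⟩ :=
        exploitable_of_tie hT' hT hd0 hγ0 hγ1 hnt' hπ hπ' h'.symm h
      exact ⟨y, x, hy, hx, hyx, hxy⟩
end

section
/- On any policy set with collinear visit counts, every non-trivial, non-equivalent pair of reward functions is hackable. Precisely: fix a finite environment (S, A, T, d0, γ) and a policy set Π of stationary policies such that all visit-count vectors {F^π : π ∈ Π} lie on a single line in ℝ^{S×A}. If R and R' are reward functions such that neither J_R nor J_{R'} is constant on Π and J_R, J_{R'} do not induce the same ordering on Π, then there exist π, π' ∈ Π with J_R(π) > J_R(π') and J_{R'}(π') > J_{R'}(π). -/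
open Matrix

/-- If the visit counts of `π` and `π'` lie on a line with direction `u`, the difference of their
values is `⟨R, u⟩` times the difference of the line parameters. -/
theorem JvisF_sub_of_visitCount_eq {S A : Type*} [Fintype S] [Fintype A] [DecidableEq S]
    {T : S → A → S → ℝ} {d0 : S → ℝ} {γ : ℝ} {x u : S → A → ℝ} {π π' : S → A → ℝ} {c c' : ℝ}
    (h : visitCount T d0 γ π = x + c • u) (h' : visitCount T d0 γ π' = x + c' • u)
    (R : S → A → ℝ) :
    JvisF T R d0 γ π - JvisF T R d0 γ π' = (c - c') * ∑ s, ∑ a, R s a * u s a := by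
  simp only [JvisF, h, h', Finset.mul_sum, ← Finset.sum_sub_distrib]
  refine Finset.sum_congr rfl fun s _ => Finset.sum_congr rfl fun a _ => ?_
  simp only [Pi.add_apply, Pi.smul_apply, smul_eq_mul]
  ring

/-- **Collinear visit counts force hackability**: on any policy set whose
visit-count vectors lie on a single line in `ℝ^{S×A}`, every non-trivial,
non-equivalent pair of reward functions is hackable. -/
theorem stmt1 {S A : Type*} [Fintype S] [Fintype A] [DecidableEq S] [Nonempty S]
    (hA : 1 < Fintype.card A)
    (T : S → A → S → ℝ) (hT : IsTransModel T)
    (d0 : S → ℝ) (hd0 : IsDist d0)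
    (γ : ℝ) (hγ0 : 0 ≤ γ) (hγ1 : γ < 1)
    (Ps : Set (S → A → ℝ)) (hPs : ∀ p ∈ Ps, IsPolicy p)
    -- the visit counts of `Ps` lie on a single line in `ℝ^{S×A}`
    (hcol : ∃ x u : S → A → ℝ, ∀ π ∈ Ps, ∃ c : ℝ,
      visitCount T d0 γ π = x + c • u)
    (R R' : S → A → ℝ)
    -- `J_R` is non-trivial (non-constant) on `Ps`
    (hnt : ∃ π ∈ Ps, ∃ π' ∈ Ps, JvisF T R d0 γ π ≠ JvisF T R d0 γ π')
    -- `J_{R'}` is non-trivial (non-constant) on `Ps`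
    (hnt' : ∃ π ∈ Ps, ∃ π' ∈ Ps, JvisF T R' d0 γ π ≠ JvisF T R' d0 γ π')
    -- `J_R` and `J_{R'}` do not induce the same ordering on `Ps`
    (hneq : ¬ ∀ π ∈ Ps, ∀ π' ∈ Ps,
      (JvisF T R d0 γ π' ≤ JvisF T R d0 γ π ↔
        JvisF T R' d0 γ π' ≤ JvisF T R' d0 γ π)) :
    ∃ π ∈ Ps, ∃ π' ∈ Ps,
      JvisF T R d0 γ π' < JvisF T R d0 γ π ∧
      JvisF T R' d0 γ π < JvisF T R' d0 γ π' := by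
  obtain ⟨x, u, hxu⟩ := hcol
  choose! c hc using hxu
  have key (Q : S → A → ℝ) {π π' : S → A → ℝ} (h : π ∈ Ps) (h' : π' ∈ Ps) :=
    JvisF_sub_of_visitCount_eq (hc π h) (hc π' h') Q
  set b := ∑ s, ∑ a, R s a * u s a
  set b' := ∑ s, ∑ a, R' s a * u s a
  obtain ⟨p, hp, q, hq, hpq⟩ := hnt
  have hb : (c p - c q) * b ≠ 0 := key R hp hq ▸ sub_ne_zero.mpr hpq
  have hb' : b' ≠ 0 := by
    obtain ⟨p', hp', q', hq', hpq'⟩ := hnt'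
    exact right_ne_zero_of_mul (key R' hp' hq' ▸ sub_ne_zero.mpr hpq')
  have hsign : b * b' < 0 := by
    refine lt_of_not_ge fun hge => hneq fun π h π' h' => ?_
    have hpos : 0 < b * b' := lt_of_le_of_ne hge (mul_ne_zero (right_ne_zero_of_mul hb) hb').symm
    rw [← sub_nonneg, key R h h', ← sub_nonneg (b := JvisF T R' d0 γ π'), key R' h h']
    rcases pos_and_pos_or_neg_and_neg_of_mul_pos hpos with ⟨h1, h2⟩ | ⟨h1, h2⟩
    · rw [mul_nonneg_iff_of_pos_right h1, mul_nonneg_iff_of_pos_right h2]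
    · rw [← neg_mul_neg _ b, ← neg_mul_neg _ b', mul_nonneg_iff_of_pos_right (neg_pos.mpr h1),
        mul_nonneg_iff_of_pos_right (neg_pos.mpr h2)]
  have opposite {π π' : S → A → ℝ} (h : π ∈ Ps) (h' : π' ∈ Ps)
      (hlt : JvisF T R d0 γ π' < JvisF T R d0 γ π) :
      JvisF T R' d0 γ π < JvisF T R' d0 γ π' := by
    have h1 := key R h h'
    have h2 := key R' h h'
    have hpos : 0 < (c π - c π') * b := by linarith
    have hc0 : c π - c π' ≠ 0 := left_ne_zero_of_mul hpos.ne'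
    by_contra! hle
    have hnonneg : 0 ≤ (c π - c π') * b' := by linarith
    nlinarith [mul_nonneg hpos.le hnonneg, mul_neg_of_pos_of_neg (sq_pos_of_ne_zero hc0) hsign]
  rcases hpq.lt_or_gt with hlt | hlt
  · exact ⟨q, hq, p, hp, hlt, opposite hq hp hlt⟩
  · exact ⟨p, hp, q, hq, hlt, opposite hp hq hlt⟩
end

section
/- Model exploitation implies reward hacking: fix a finite task (S, A, d0, R, γ) and a policy set Π of stationary policies. If a pair of transition models (T, T') is exploitable relative to Π (there exist π, π' ∈ Π with J_T(π) > J_T(π') and J_{T'}(π') > J_{T'}(π)), then there exists a reward function R' (namely R' = F_T^{π'} − F_T^{π}, the difference of discounted visit counts under T of an exploiting pair) such that (R, R') is hackable relative to Π in the environment with transition model T: there exist σ, σ' ∈ Π with J_{T,R}(σ) > J_{T,R}(σ') and J_{T,R'}(σ') > J_{T,R'}(σ). -/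
open Matrix

/-- If two policies have different values, then their visit counts differ, and rewarding the
difference of visit counts strictly separates them. -/
theorem JvisF_visitCount_sub_lt {S A : Type*} [Fintype S] [Fintype A] [DecidableEq S]
    (T : S → A → S → ℝ) (R : S → A → ℝ) (d0 : S → ℝ) (γ : ℝ) {π π' : S → A → ℝ}
    (h : JvisF T R d0 γ π' ≠ JvisF T R d0 γ π) :
    JvisF T (visitCount T d0 γ π' - visitCount T d0 γ π) d0 γ π <
      JvisF T (visitCount T d0 γ π' - visitCount T d0 γ π) d0 γ π' := by
  have hne : ∃ s a, visitCount T d0 γ π' s a ≠ visitCount T d0 γ π s a := by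
    by_contra! heq
    exact h (by simp only [JvisF, heq])
  obtain ⟨s, a, hsa⟩ := hne
  rw [← sub_pos]
  simp only [JvisF, ← Finset.sum_sub_distrib, ← mul_sub, Pi.sub_apply]
  have hnonneg : ∀ s, 0 ≤ ∑ a, (visitCount T d0 γ π' s a - visitCount T d0 γ π s a) *
      (visitCount T d0 γ π' s a - visitCount T d0 γ π s a) :=
    fun s => Finset.sum_nonneg fun a _ => mul_self_nonneg _
  refine Finset.sum_pos' (fun s _ => hnonneg s) ⟨s, Finset.mem_univ s, ?_⟩
  exact Finset.sum_pos' (fun a _ => mul_self_nonneg _)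
    ⟨a, Finset.mem_univ a, mul_self_pos.mpr (sub_ne_zero.mpr hsa)⟩

/-- **Exploitation implies hacking**: if a pair of transition models `(T, T')`
is exploitable relative to a policy set `Ps` and the task with reward `R`, then
there is a reward function `R'` such that `(R, R')` is hackable relative to
`Ps` in the environment with transition model `T`. -/
theorem stmt2 {S A : Type*} [Fintype S] [Fintype A] [DecidableEq S] [Nonempty S]
    (hA : 1 < Fintype.card A)
    (d0 : S → ℝ) (hd0 : IsDist d0)
    (γ : ℝ) (hγ0 : 0 ≤ γ) (hγ1 : γ < 1)
    (R : S → A → ℝ)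
    (Ps : Set (S → A → ℝ)) (hPs : ∀ p ∈ Ps, IsPolicy p)
    (T T' : S → A → S → ℝ) (hT : IsTransModel T) (hT' : IsTransModel T')
    -- `(T, T')` is exploitable on `Ps`
    (hexp : ∃ π ∈ Ps, ∃ π' ∈ Ps,
      JvisF T R d0 γ π' < JvisF T R d0 γ π ∧
      JvisF T' R d0 γ π < JvisF T' R d0 γ π') :
    -- then some reward `R'` makes `(R, R')` hackable on `Ps` in the
    -- environment with transition model `T`
    ∃ R' : S → A → ℝ, ∃ σ ∈ Ps, ∃ σ' ∈ Ps,
      JvisF T R d0 γ σ' < JvisF T R d0 γ σ ∧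
      JvisF T R' d0 γ σ < JvisF T R' d0 γ σ' := by
  obtain ⟨π, hπ, π', hπ', hlt, -⟩ := hexp
  exact ⟨visitCount T d0 γ π' - visitCount T d0 γ π, π, hπ, π', hπ', hlt,
    JvisF_visitCount_sub_lt T R d0 γ hlt.ne⟩
end

section
/- Connected level sets: for any finite MDP (S, A, T, d0, R, γ) with γ ∈ [0,1), every level set of the value function restricted to the interior of the policy space is connected; that is, for every c ∈ ℝ, the set {π ∈ Π^+ : J_T(π) = c} is a connected subset of ℝ^{S×A}. -/
open Matrix

section Occupancy

variable {S A : Type*} [Fintype S] [Fintype A]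

/-- The expected one-step transition probabilities of a policy are nonnegative. -/
lemma Pmat_nonneg {T : S → A → S → ℝ} (hT : IsTransModel T) {π : S → A → ℝ}
    (hπ : IsPolicy π) (x y : S) : 0 ≤ Pmat T π x y :=
  Finset.sum_nonneg fun a _ => mul_nonneg ((hπ x).1 a) ((hT x a).1 y)

/-- The rows of the transition matrix of a policy sum to one. -/
lemma Pmat_row_sum {T : S → A → S → ℝ} (hT : IsTransModel T) {π : S → A → ℝ}
    (hπ : IsPolicy π) (s : S) : ∑ s', Pmat T π s s' = 1 := by
  simp only [Pmat, Matrix.of_apply]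
  rw [Finset.sum_comm]
  simp only [← Finset.mul_sum, (hT s _).2, mul_one, (hπ s).2]

/-- A nonnegative vector dominated by its discounted image under a row-stochastic matrix
vanishes. -/
lemma eq_zero_of_le_discounted {P : Matrix S S ℝ} (hP : ∀ s, ∑ s', P s s' = 1)
    {γ : ℝ} (hγ1 : γ < 1) {u : S → ℝ} (hu : ∀ s, 0 ≤ u s)
    (hle : ∀ s', u s' ≤ γ * ∑ s, u s * P s s') (s : S) : u s = 0 := by
  have hsum : ∑ s', u s' ≤ γ * ∑ s, u s := by
    calc ∑ s', u s' ≤ ∑ s', γ * ∑ s, u s * P s s' := Finset.sum_le_sum fun s' _ => hle s'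
      _ = γ * ∑ s, u s := by
        rw [← Finset.mul_sum, Finset.sum_comm]
        simp only [← Finset.mul_sum, hP, mul_one]
  have h0 : 0 ≤ ∑ s, u s := Finset.sum_nonneg fun s _ => hu s
  have hz : ∑ s, u s = 0 := by nlinarith
  exact (Finset.sum_eq_zero_iff_of_nonneg fun s _ => hu s).1 hz s (Finset.mem_univ s)

/-- `μ` solves the Bellman flow equations of the policy `π`. -/
def IsOccupancy (T : S → A → S → ℝ) (d0 : S → ℝ) (γ : ℝ) (π : S → A → ℝ)
    (μ : S → ℝ) : Prop :=
  ∀ s', μ s' = d0 s' + γ * ∑ s, μ s * Pmat T π s s'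

variable {T : S → A → S → ℝ} {d0 : S → ℝ} {γ : ℝ} {π : S → A → ℝ}

lemma IsOccupancy.nonneg (hT : IsTransModel T) (hd0 : IsDist d0) (hγ0 : 0 ≤ γ) (hγ1 : γ < 1)
    (hπ : IsPolicy π) {μ : S → ℝ} (hμ : IsOccupancy T d0 γ π μ) (s : S) : 0 ≤ μ s := by
  have key : max (-μ s) 0 = 0 := by
    refine eq_zero_of_le_discounted (u := fun s => max (-μ s) 0) (Pmat_row_sum hT hπ) hγ1
      (fun s => le_max_right _ _) (fun s' => ?_) s
    refine max_le ?_ (mul_nonneg hγ0 (Finset.sum_nonneg fun s _ =>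
      mul_nonneg (le_max_right _ _) (Pmat_nonneg hT hπ s s')))
    have h1 : -∑ s, μ s * Pmat T π s s' ≤ ∑ s, max (-μ s) 0 * Pmat T π s s' := by
      rw [← Finset.sum_neg_distrib]
      refine Finset.sum_le_sum fun s _ => ?_
      rw [← neg_mul]
      exact mul_le_mul_of_nonneg_right (le_max_left _ _) (Pmat_nonneg hT hπ s s')
    have h2 := hμ s'
    have h3 := hd0.1 s'
    have h4 := mul_le_mul_of_nonneg_left h1 hγ0
    linarith
  linarith [max_eq_right_iff.1 key]

/-- A state that is not visited under one fully mixed policy is not visited under any policy. -/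
lemma IsOccupancy.eq_zero_of_eq_zero (hT : IsTransModel T) (hd0 : IsDist d0)
    (hγ0 : 0 ≤ γ) (hγ1 : γ < 1) (hπ : π ∈ PiPlus) {π' : S → A → ℝ} (hπ' : IsPolicy π')
    {μ μ' : S → ℝ} (hμ : IsOccupancy T d0 γ π μ) (hμ' : IsOccupancy T d0 γ π' μ')
    {s : S} (hs : μ s = 0) : μ' s = 0 := by
  classical
  have hμ0 := hμ.nonneg hT hd0 hγ0 hγ1 hπ.1
  have hμ'0 := hμ'.nonneg hT hd0 hγ0 hγ1 hπ'
  have hin : ∀ x, 0 ≤ ∑ y, μ y * Pmat T π y x := fun x =>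
    Finset.sum_nonneg fun y _ => mul_nonneg (hμ0 y) (Pmat_nonneg hT hπ.1 y x)
  have hd : ∀ x, μ x = 0 → d0 x = 0 := fun x hx => by
    have h1 := hμ x
    have h2 := mul_nonneg hγ0 (hin x)
    have h3 := hd0.1 x
    linarith
  have hflow : ∀ x y, μ x = 0 → μ y ≠ 0 → γ * Pmat T π' y x = 0 := by
    intro x y hx hy
    have h1 : γ * ∑ y, μ y * Pmat T π y x = 0 := by
      have h1 := hμ x
      rw [hx, hd x hx] at h1
      linarith
    rcases mul_eq_zero.1 h1 with h | h
    · rw [h, zero_mul]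
    have h2 := (Finset.sum_eq_zero_iff_of_nonneg fun y _ =>
      mul_nonneg (hμ0 y) (Pmat_nonneg hT hπ.1 y x)).1 h y (Finset.mem_univ y)
    have h3 : ∑ a, π y a * T y a x = 0 := (mul_eq_zero.1 h2).resolve_left hy
    have h4 : ∀ a, T y a x = 0 := fun a =>
      (mul_eq_zero.1 ((Finset.sum_eq_zero_iff_of_nonneg fun a _ =>
        mul_nonneg (hπ.2 y a).le ((hT y a).1 x)).1 h3 a (Finset.mem_univ a))).resolve_left
        (hπ.2 y a).ne'
    simp [Pmat, h4]
  have key := eq_zero_of_le_discounted (u := fun x => if μ x = 0 then μ' x else 0)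
    (Pmat_row_sum hT hπ') hγ1 (fun x => by split_ifs <;> simp [hμ'0 x]) (fun x => by
      split_ifs with hx
      · rw [hμ' x, hd x hx, zero_add, Finset.mul_sum, Finset.mul_sum]
        refine Finset.sum_le_sum fun y _ => ?_
        split_ifs with hy
        · exact le_rfl
        · rw [mul_left_comm, hflow x y hx hy]
          simp
      · refine mul_nonneg hγ0 (Finset.sum_nonneg fun y _ => mul_nonneg ?_
          (Pmat_nonneg hT hπ' y x))
        split_ifs <;> simp [hμ'0 y]) s
  simpa [hs] using key

variable [DecidableEq S]

lemma isUnit_det_one_sub_discounted (hT : IsTransModel T) (hγ0 : 0 ≤ γ) (hγ1 : γ < 1)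
    (hπ : IsPolicy π) : IsUnit ((1 : Matrix S S ℝ) - γ • Pmat T π).det := by
  rw [isUnit_iff_ne_zero]
  intro hdet
  obtain ⟨v, hv, hv0⟩ := Matrix.exists_vecMul_eq_zero_iff.2 hdet
  refine hv (funext fun s => abs_eq_zero.1 ?_)
  refine eq_zero_of_le_discounted (u := fun s => |v s|) (Pmat_row_sum hT hπ) hγ1
    (fun s => abs_nonneg _) (fun s' => ?_) s
  have h := congrFun hv0 s'
  rw [Matrix.vecMul_sub, Matrix.vecMul_one, Matrix.vecMul_smul] at h
  have h1 : v s' = γ * ∑ s, v s * Pmat T π s s' := by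
    simpa [sub_eq_zero, Matrix.vecMul, dotProduct] using h
  rw [h1, abs_mul, abs_of_nonneg hγ0]
  refine mul_le_mul_of_nonneg_left ((Finset.abs_sum_le_sum_abs _ _).trans ?_) hγ0
  refine Finset.sum_le_sum fun s _ => ?_
  rw [abs_mul, abs_of_nonneg (Pmat_nonneg hT hπ s s')]

lemma isOccupancy_iff_vecMul {μ : S → ℝ} :
    IsOccupancy T d0 γ π μ ↔ μ ᵥ* ((1 : Matrix S S ℝ) - γ • Pmat T π) = d0 := by
  rw [Matrix.vecMul_sub, Matrix.vecMul_one, Matrix.vecMul_smul, funext_iff]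
  refine forall_congr' fun s' => ?_
  simp only [Pi.sub_apply, Pi.smul_apply, smul_eq_mul, Matrix.vecMul, dotProduct]
  exact sub_eq_iff_eq_add.symm

lemma exists_isOccupancy (hT : IsTransModel T) (hγ0 : 0 ≤ γ) (hγ1 : γ < 1)
    (hπ : IsPolicy π) : ∃ μ, IsOccupancy T d0 γ π μ :=
  ⟨d0 ᵥ* ((1 : Matrix S S ℝ) - γ • Pmat T π)⁻¹, isOccupancy_iff_vecMul.2 <| by
    rw [Matrix.vecMul_vecMul, Matrix.nonsing_inv_mul _
      (isUnit_det_one_sub_discounted hT hγ0 hγ1 hπ), Matrix.vecMul_one]⟩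

/-- The value of a policy is the reward averaged over its occupancy measure. -/
lemma IsOccupancy.Jval_eq (hT : IsTransModel T) (hγ0 : 0 ≤ γ) (hγ1 : γ < 1)
    (hπ : IsPolicy π) {μ : S → ℝ} (hμ : IsOccupancy T d0 γ π μ) (R : S → A → ℝ) :
    Jval T R d0 γ π = ∑ s, ∑ a, μ s * π s a * R s a := by
  have h : Jval T R d0 γ π =
      d0 ⬝ᵥ (((1 : Matrix S S ℝ) - γ • Pmat T π)⁻¹ *ᵥ rvec R π) := rfl
  rw [h, ← isOccupancy_iff_vecMul.1 hμ, Matrix.dotProduct_mulVec, Matrix.vecMul_vecMul,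
    Matrix.mul_nonsing_inv _ (isUnit_det_one_sub_discounted hT hγ0 hγ1 hπ), Matrix.vecMul_one]
  simp only [dotProduct, rvec, Finset.mul_sum, mul_assoc]

end Occupancy

/-- The policy at time `t` on the path from `π₀` to `π₁` that mixes the two policies in each
state with weights proportional to `(1 - t) * w₀` and `t * w₁`. -/
noncomputable def weightedMix {S A : Type*} (w₀ w₁ : S → ℝ) (π₀ π₁ : S → A → ℝ) (t : ℝ) :
    S → A → ℝ :=
  fun s a => ((1 - t) * (w₀ s * π₀ s a) + t * (w₁ s * π₁ s a)) / ((1 - t) * w₀ s + t * w₁ s)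

section WeightedMix

variable {S A : Type*} {w₀ w₁ : S → ℝ} {π₀ π₁ : S → A → ℝ}

lemma convexComb_pos {x y t : ℝ} (hx : 0 < x) (hy : 0 < y) (ht : t ∈ Set.Icc (0 : ℝ) 1) :
    0 < (1 - t) * x + t * y :=
  convex_Ioi (0 : ℝ) hx hy (sub_nonneg.2 ht.2) ht.1 (sub_add_cancel 1 t)

lemma weightedMix_mem_PiPlus [Fintype A] (hw₀ : ∀ s, 0 < w₀ s) (hw₁ : ∀ s, 0 < w₁ s)
    (hπ₀ : π₀ ∈ PiPlus) (hπ₁ : π₁ ∈ PiPlus) {t : ℝ} (ht : t ∈ Set.Icc (0 : ℝ) 1) :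
    weightedMix w₀ w₁ π₀ π₁ t ∈ PiPlus := by
  have hpos : ∀ s a, 0 < weightedMix w₀ w₁ π₀ π₁ t s a := fun s a =>
    div_pos (convexComb_pos (mul_pos (hw₀ s) (hπ₀.2 s a)) (mul_pos (hw₁ s) (hπ₁.2 s a)) ht)
      (convexComb_pos (hw₀ s) (hw₁ s) ht)
  refine ⟨fun s => ⟨fun a => (hpos s a).le, ?_⟩, hpos⟩
  simp only [weightedMix]
  rw [← Finset.sum_div, Finset.sum_add_distrib]
  simp only [← Finset.mul_sum, (hπ₀.1 s).2, (hπ₁.1 s).2, mul_one]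
  exact div_self (convexComb_pos (hw₀ s) (hw₁ s) ht).ne'

lemma continuousOn_weightedMix (hw₀ : ∀ s, 0 < w₀ s) (hw₁ : ∀ s, 0 < w₁ s) :
    ContinuousOn (weightedMix w₀ w₁ π₀ π₁) (Set.Icc 0 1) := by
  refine continuousOn_pi.2 fun s => continuousOn_pi.2 fun a => ?_
  exact ContinuousOn.div (by fun_prop) (by fun_prop)
    fun t ht => (convexComb_pos (hw₀ s) (hw₁ s) ht).ne'

end WeightedMix

/-- **Connected level sets**: every level set of the value function on the
interior `Π⁺` of the policy space is connected (formalized as preconnected,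
which is the standard notion of "connected" allowing the empty set). -/
theorem stmt5 {S A : Type*} [Fintype S] [Fintype A] [DecidableEq S] [Nonempty S]
    (hA : 1 < Fintype.card A)
    (T : S → A → S → ℝ) (hT : IsTransModel T)
    (d0 : S → ℝ) (hd0 : IsDist d0)
    (R : S → A → ℝ)
    (γ : ℝ) (hγ0 : 0 ≤ γ) (hγ1 : γ < 1)
    (c : ℝ) :
    IsPreconnected {π : S → A → ℝ | π ∈ PiPlus ∧ Jval T R d0 γ π = c} := by
  classical
  refine isPreconnected_of_forall_pair ?_
  rintro π₀ ⟨hπ₀, hJ₀⟩ π₁ ⟨hπ₁, hJ₁⟩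
  obtain ⟨μ₀, hμ₀⟩ := exists_isOccupancy (d0 := d0) hT hγ0 hγ1 hπ₀.1
  obtain ⟨μ₁, hμ₁⟩ := exists_isOccupancy (d0 := d0) hT hγ0 hγ1 hπ₁.1
  have hzero : ∀ s, μ₀ s = 0 ↔ μ₁ s = 0 := fun s =>
    ⟨hμ₀.eq_zero_of_eq_zero hT hd0 hγ0 hγ1 hπ₀ hπ₁.1 hμ₁,
      hμ₁.eq_zero_of_eq_zero hT hd0 hγ0 hγ1 hπ₁ hπ₀.1 hμ₀⟩
  let w (μ : S → ℝ) (s : S) : ℝ := if μ s = 0 then 1 else μ s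
  have hw : ∀ μ : S → ℝ, (∀ s, 0 ≤ μ s) → ∀ s, 0 < w μ s := fun μ hμ s => by
    by_cases h : μ s = 0
    · simp [w, h]
    · simpa [w, h] using (hμ s).lt_of_ne' h
  have hw₀ := hw μ₀ (hμ₀.nonneg hT hd0 hγ0 hγ1 hπ₀.1)
  have hw₁ := hw μ₁ (hμ₁.nonneg hT hd0 hγ0 hγ1 hπ₁.1)
  let path := weightedMix (w μ₀) (w μ₁) π₀ π₁
  refine ⟨Set.image path (Set.Icc 0 1), ?_, ⟨0, by simp, ?_⟩, ⟨1, by simp, ?_⟩,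
    isPreconnected_Icc.image _ (continuousOn_weightedMix hw₀ hw₁)⟩
  · rintro _ ⟨t, ht, rfl⟩
    have hmem : path t ∈ PiPlus := weightedMix_mem_PiPlus hw₀ hw₁ hπ₀ hπ₁ ht
    refine ⟨hmem, ?_⟩
    have hF : ∀ s a, ((1 - t) * μ₀ s + t * μ₁ s) * path t s a =
        (1 - t) * (μ₀ s * π₀ s a) + t * (μ₁ s * π₁ s a) := by
      intro s a
      by_cases h : μ₀ s = 0
      · simp [h, (hzero s).1 h]
      · have h' : μ₁ s ≠ 0 := fun h' => h ((hzero s).2 h')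
        have hne := (convexComb_pos (hw₀ s) (hw₁ s) ht).ne'
        simp only [w, h, h', if_false] at hne
        simp only [path, weightedMix, w, h, h', if_false]
        exact mul_div_cancel₀ _ hne
    have hμ : IsOccupancy T d0 γ (path t) fun s => (1 - t) * μ₀ s + t * μ₁ s := by
      intro s'
      have hP : ∑ s, ((1 - t) * μ₀ s + t * μ₁ s) * Pmat T (path t) s s' =
          (1 - t) * ∑ s, μ₀ s * Pmat T π₀ s s' + t * ∑ s, μ₁ s * Pmat T π₁ s s' := by
        simp only [Pmat, Matrix.of_apply, Finset.mul_sum, ← Finset.sum_add_distrib]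
        refine Finset.sum_congr rfl fun s _ => Finset.sum_congr rfl fun a _ => ?_
        linear_combination T s a s' * hF s a
      rw [hP]
      linear_combination (1 - t) * hμ₀ s' + t * hμ₁ s'
    have hJ : ∑ s, ∑ a, ((1 - t) * μ₀ s + t * μ₁ s) * path t s a * R s a =
        (1 - t) * ∑ s, ∑ a, μ₀ s * π₀ s a * R s a + t * ∑ s, ∑ a, μ₁ s * π₁ s a * R s a := by
      simp only [Finset.mul_sum, ← Finset.sum_add_distrib]
      refine Finset.sum_congr rfl fun s _ => Finset.sum_congr rfl fun a _ => ?_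
      linear_combination R s a * hF s a
    rw [hμ.Jval_eq hT hγ0 hγ1 hmem.1, hJ, ← hμ₀.Jval_eq hT hγ0 hγ1 hπ₀.1,
      ← hμ₁.Jval_eq hT hγ0 hγ1 hπ₁.1, hJ₀, hJ₁]
    ring
  · funext s a
    simp [path, weightedMix, (hw₀ s).ne']
  · funext s a
    simp [path, weightedMix, (hw₁ s).ne']
end

section
/- Global equivalence lemma: fix a finite task (S, A, d0, R, γ) and two transition models T_1, T_2 with value functions J_1, J_2. Let Π be any set of stationary policies and let Π̃ ⊆ Π be a nonempty subset open in Π^+. Suppose J_1 and J_2 are each non-constant on Π^+, and that at every π ∈ Π̃ where both tangential gradients ∇J_1(π) and ∇J_2(π) are nonzero, they are positively proportional (∇J_2(π) = λ(π)∇J_1(π) for some λ(π) > 0). Then J_1 and J_2 are equivalent on Π: for all π, π' ∈ Π, J_1(π) ≥ J_1(π') ⟺ J_2(π) ≥ J_2(π'). -/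
open Matrix

/-- The tangent space of the product of simplices: directions summing to zero
at each state. -/
def IsTangent {S A : Type*} [Fintype A] (v : S → A → ℝ) : Prop :=
  ∀ s, ∑ a, v s a = 0

/-- The tangential gradient of `J` at `π` is nonzero iff some tangent
directional derivative is nonzero. -/
def TangGradNeZero {S A : Type*} [Fintype S] [Fintype A]
    (J : (S → A → ℝ) → ℝ) (π : S → A → ℝ) : Prop :=
  ∃ v : S → A → ℝ, IsTangent v ∧ fderiv ℝ J π v ≠ 0

open Filter Topology

/-- A function whose differential vanishes on the kernel of `dF` is constant along the level curves
of `F`; if these are transverse to the first axis and the function vanishes on that axis, then it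
vanishes near the origin. -/
lemma eventually_eq_zero_of_ker_fderiv_le {F h : ℝ × ℝ → ℝ} (hF : ContDiffAt ℝ 1 F 0)
    (hh : ∀ᶠ z in 𝓝 0, DifferentiableAt ℝ h z) (hF1 : fderiv ℝ F 0 (1, 0) ≠ 0)
    (hker : ∀ᶠ z in 𝓝 0, ∀ p, fderiv ℝ F z p = 0 → fderiv ℝ h z p = 0)
    (h0 : ∀ᶠ t in 𝓝 (0 : ℝ), h (t, 0) = 0) : ∀ᶠ z in 𝓝 0, h z = 0 := by
  set a := fderiv ℝ F 0 (1, 0) with ha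
  set b := fderiv ℝ F 0 (0, 1) with hb
  have hL : ∀ p : ℝ × ℝ, fderiv ℝ F 0 p = p.1 * a + p.2 * b := by
    intro p
    have hp : p = p.1 • ((1, 0) : ℝ × ℝ) + p.2 • ((0, 1) : ℝ × ℝ) := by ext <;> simp
    conv_lhs => rw [hp]
    rw [map_add, map_smul, map_smul, smul_eq_mul, smul_eq_mul]
  let e : (ℝ × ℝ) ≃L[ℝ] (ℝ × ℝ) := ContinuousLinearEquiv.equivOfInverse
    ((fderiv ℝ F 0).prod (ContinuousLinearMap.snd ℝ ℝ ℝ))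
    ((a⁻¹ • (ContinuousLinearMap.fst ℝ ℝ ℝ - b • ContinuousLinearMap.snd ℝ ℝ ℝ)).prod
      (ContinuousLinearMap.snd ℝ ℝ ℝ))
    (fun p => by ext <;> simp [hL]; field_simp; ring)
    (fun p => by ext <;> simp [hL]; field_simp; ring)
  let Ψ : ℝ × ℝ → ℝ × ℝ := fun z => (F z, z.2)
  have hΨ : ContDiffAt ℝ 1 Ψ 0 := hF.prodMk contDiffAt_snd
  have hΨ' : HasFDerivAt Ψ (e : (ℝ × ℝ) →L[ℝ] (ℝ × ℝ)) 0 :=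
    (hF.differentiableAt one_ne_zero).hasFDerivAt.prodMk hasFDerivAt_snd
  have hs := hΨ.hasStrictFDerivAt' hΨ' one_ne_zero
  have hright := hs.eventually_right_inverse
  have hleft := hs.eventually_left_inverse
  have hg0 := hs.localInverse_apply_image
  have hgc : ContDiffAt ℝ 1 (hs.localInverse Ψ e 0) (Ψ 0) := hΨ.to_localInverse hΨ' one_ne_zero
  generalize hs.localInverse Ψ e 0 = g at hright hleft hg0 hgc
  have hgt : Tendsto g (𝓝 (Ψ 0)) (𝓝 0) := by
    have := hgc.continuousAt.tendsto
    rwa [hg0] at this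
  have hFd : ∀ᶠ z in 𝓝 0, DifferentiableAt ℝ F z :=
    (hF.eventually (by simp)).mono fun z hz => hz.differentiableAt one_ne_zero
  have hgd : ∀ᶠ q in 𝓝 (Ψ 0), DifferentiableAt ℝ g q :=
    (hgc.eventually (by simp)).mono fun z hz => hz.differentiableAt one_ne_zero
  have hax : ∀ᶠ z in 𝓝 (0 : ℝ × ℝ), h (z.1, 0) = 0 :=
    (continuous_fst.tendsto (0 : ℝ × ℝ)).eventually h0
  have hall := hright.eventually_nhds.and (hgd.and (hgt.eventually
    (hFd.and (hh.and (hker.and hax)))))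
  obtain ⟨r, hr, hball⟩ := Metric.eventually_nhds_iff_ball.1 hall
  have hmem : ∀ᶠ z in 𝓝 (0 : ℝ × ℝ), Ψ z ∈ Metric.ball (Ψ 0) r :=
    hΨ.continuousAt.eventually (Metric.ball_mem_nhds _ hr)
  filter_upwards [hleft, hmem] with z hz hzm
  have hprod : ∀ y u : ℝ, (y, u) ∈ Metric.ball (Ψ 0) r ↔
      y ∈ Metric.ball (F 0) r ∧ u ∈ Metric.ball (0 : ℝ) r := by
    intro y u
    simp [Ψ, Metric.mem_ball, Prod.dist_eq]
  have hz1 := (hprod _ _).1 hzm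
  have hder : ∀ u ∈ Metric.ball (0 : ℝ) r, HasDerivAt (fun u => h (g (F z, u))) 0 u := by
    intro u hu
    obtain ⟨h1, h2, h3, h4, h5, -⟩ := hball _ ((hprod _ _).2 ⟨hz1.1, hu⟩)
    have hl : HasDerivAt (fun u : ℝ => (F z, u)) ((0, 1) : ℝ × ℝ) u :=
      (hasDerivAt_const u (F z)).prodMk (hasDerivAt_id u)
    have hgl := h2.hasFDerivAt.comp_hasDerivAt u hl
    have hFl := h3.hasFDerivAt.comp_hasDerivAt u hgl
    have hhl := h4.hasFDerivAt.comp_hasDerivAt u hgl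
    have hconst : HasDerivAt (F ∘ g ∘ fun u : ℝ => (F z, u)) 0 u := by
      refine (hasDerivAt_const u (F z)).congr_of_eventuallyEq ?_
      filter_upwards [hl.continuousAt.eventually h1] with u' hu'
      exact congrArg Prod.fst hu'
    have := h5 _ (hFl.unique hconst)
    rw [this] at hhl
    exact hhl
  have hc := Metric.isOpen_ball.is_const_of_deriv_eq_zero (convex_ball (0 : ℝ) r).isPreconnected
    (fun u hu => (hder u hu).differentiableAt.differentiableWithinAt)
    (fun u hu => (hder u hu).deriv) hz1.2 (Metric.mem_ball_self hr)
  have hzg : h (g (F z, z.2)) = h z := congrArg h hz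
  rw [← hzg, hc]
  obtain ⟨h1, -, -, -, -, h6⟩ := hball _ ((hprod _ _).2 ⟨hz1.1, Metric.mem_ball_self hr⟩)
  have hsnd : (g (F z, 0)).2 = 0 := congrArg Prod.snd h1.self_of_nhds
  rwa [show ((g (F z, 0)).1, (0 : ℝ)) = g (F z, 0) from Prod.ext rfl hsnd.symm] at h6

lemma analyticAt_det {E n : Type*} [NormedAddCommGroup E] [NormedSpace ℝ E] [Fintype n]
    [DecidableEq n] {M : E → Matrix n n ℝ} {x : E}
    (hM : ∀ i j, AnalyticAt ℝ (fun y => M y i j) x) : AnalyticAt ℝ (fun y => (M y).det) x := by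
  simp only [Matrix.det_apply']
  exact Finset.analyticAt_fun_sum _ fun σ _ =>
    analyticAt_const.mul (Finset.analyticAt_fun_prod _ fun i _ => hM _ _)

lemma analyticAt_inv_apply {E n : Type*} [NormedAddCommGroup E] [NormedSpace ℝ E] [Fintype n]
    [DecidableEq n] {M : E → Matrix n n ℝ} {x : E}
    (hM : ∀ i j, AnalyticAt ℝ (fun y => M y i j) x) (hdet : (M x).det ≠ 0) (i j : n) :
    AnalyticAt ℝ (fun y => (M y)⁻¹ i j) x := by
  simp only [Matrix.inv_def, Ring.inverse_eq_inv', Matrix.smul_apply, smul_eq_mul,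
    Matrix.adjugate_apply]
  refine ((analyticAt_det hM).inv hdet).mul (analyticAt_det fun k l => ?_)
  rcases eq_or_ne k j with rfl | hk
  · simpa using analyticAt_const
  · simpa [Matrix.updateRow_ne hk] using hM k l

section MarkovDecisionProcess

variable {S A : Type*} [Fintype S] [Fintype A] [DecidableEq S]
  {T : S → A → S → ℝ} {R : S → A → ℝ} {d0 : S → ℝ} {γ : ℝ}

lemma det_one_sub_smul_Pmat_ne_zero (hT : IsTransModel T) (hγ0 : 0 ≤ γ) (hγ1 : γ < 1)
    {π : S → A → ℝ} (hπ : IsPolicy π) : (1 - γ • Pmat T π).det ≠ 0 := by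
  have hP0 : ∀ s s', 0 ≤ Pmat T π s s' := fun s s' =>
    Finset.sum_nonneg fun a _ => mul_nonneg ((hπ s).1 a) ((hT s a).1 s')
  have hP1 : ∀ s, ∑ s', Pmat T π s s' = 1 := by
    intro s
    simp only [Pmat, Matrix.of_apply]
    rw [Finset.sum_comm]
    simp [← Finset.mul_sum, (hT s _).2, (hπ s).2]
  refine det_ne_zero_of_sum_row_lt_diag fun k => ?_
  have hoff : ∀ j ∈ Finset.univ.erase k,
      ‖(1 - γ • Pmat T π) k j‖ = γ * Pmat T π k j := by
    intro j hj
    have hjk : k ≠ j := (Finset.ne_of_mem_erase hj).symm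
    simp [Matrix.one_apply_ne hjk, abs_of_nonneg hγ0, abs_of_nonneg (hP0 k j)]
  rw [Finset.sum_congr rfl hoff, ← Finset.mul_sum]
  have hsum := Finset.add_sum_erase Finset.univ (Pmat T π k) (Finset.mem_univ k)
  rw [hP1 k] at hsum
  have hdiag : (1 - γ • Pmat T π) k k = 1 - γ * Pmat T π k k := by simp
  rw [hdiag]
  refine lt_of_lt_of_le ?_ (le_abs_self _)
  have := congrArg (γ * ·) hsum
  simp only [mul_add, mul_one] at this
  linarith

lemma analyticAt_eval {S A : Type*} [Fintype S] [Fintype A] (π : S → A → ℝ) (s : S) (a : A) :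
    AnalyticAt ℝ (fun p : S → A → ℝ => p s a) π :=
  ((ContinuousLinearMap.proj (R := ℝ) (φ := fun _ : A => ℝ) a).comp
    (ContinuousLinearMap.proj (R := ℝ) (φ := fun _ : S => A → ℝ) s)).analyticAt π

lemma analyticAt_Jval (hT : IsTransModel T) (hγ0 : 0 ≤ γ) (hγ1 : γ < 1)
    {π : S → A → ℝ} (hπ : IsPolicy π) : AnalyticAt ℝ (Jval T R d0 γ) π := by
  have hM : ∀ i j, AnalyticAt ℝ (fun p => ((1 : Matrix S S ℝ) - γ • Pmat T p) i j) π := by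
    intro i j
    simp only [Matrix.sub_apply, Matrix.smul_apply, Pmat, Matrix.of_apply, smul_eq_mul]
    exact analyticAt_const.sub (analyticAt_const.mul (Finset.analyticAt_fun_sum _ fun a _ =>
      (analyticAt_eval π i a).mul analyticAt_const))
  unfold Jval Matrix.mulVec dotProduct rvec
  exact Finset.analyticAt_fun_sum _ fun s _ => analyticAt_const.mul <|
    Finset.analyticAt_fun_sum _ fun s' _ => (analyticAt_inv_apply hM
      (det_one_sub_smul_Pmat_ne_zero hT hγ0 hγ1 hπ) s s').mul <|
        Finset.analyticAt_fun_sum _ fun a _ => (analyticAt_eval π s' a).mul analyticAt_const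

/-- The value is a linear fractional function of the policy at a single state. -/
lemma exists_linear_fractional_Jval {π v : S → A → ℝ} {s : S} (hv : ∀ s', s' ≠ s → v s' = 0)
    (hdet : (1 - γ • Pmat T π).det ≠ 0) :
    ∃ k m : ℝ, ∀ t : ℝ, (1 - γ • Pmat T (π + t • v)).det ≠ 0 →
      (1 + k * t) * (Jval T R d0 γ (π + t • v) - Jval T R d0 γ π) = m * t := by
  set M := 1 - γ • Pmat T π with hM
  set c : S → ℝ := fun s' => -γ * ∑ a, v s a * T s a s' with hc
  set ρ : ℝ := ∑ a, v s a * R s a with hρ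
  set x : S → ℝ := M⁻¹ *ᵥ Pi.single s 1 with hx
  set V := M⁻¹ *ᵥ rvec R π with hV
  refine ⟨c ⬝ᵥ x, (ρ - c ⬝ᵥ V) * (d0 ⬝ᵥ x), fun t ht => ?_⟩
  set Mt := 1 - γ • Pmat T (π + t • v) with hMt
  set W := Mt⁻¹ *ᵥ rvec R (π + t • v) with hW
  have hMtW : Mt *ᵥ W = rvec R (π + t • v) := by
    rw [hW, Matrix.mulVec_mulVec, Matrix.mul_nonsing_inv _ (isUnit_iff_ne_zero.2 ht),
      Matrix.one_mulVec]
  have hr : rvec R (π + t • v) = rvec R π + (t * ρ) • Pi.single s 1 := by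
    ext s'
    rcases eq_or_ne s' s with rfl | hs
    · simp [rvec, hρ, add_mul, Finset.sum_add_distrib, Finset.mul_sum, mul_assoc]
    · simp [rvec, hv s' hs, hs]
  have hMM : Mt = M + t • Matrix.vecMulVec (Pi.single s 1) c := by
    ext s' s''
    rcases eq_or_ne s' s with rfl | hs
    · simp [hMt, hM, hc, Pmat, Matrix.vecMulVec_apply, add_mul, Finset.sum_add_distrib,
        Finset.mul_sum, mul_assoc, mul_add]
      simp only [mul_left_comm γ t]
      ring
    · simp [hMt, hM, Pmat, Matrix.vecMulVec_apply, hv s' hs, hs]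
  have hMW : M *ᵥ W = rvec R π + (t * (ρ - c ⬝ᵥ W)) • Pi.single s 1 := by
    have : Mt *ᵥ W = M *ᵥ W + (t * (c ⬝ᵥ W)) • Pi.single s 1 := by
      rw [hMM, Matrix.add_mulVec, Matrix.smul_mulVec, Matrix.vecMulVec_mulVec]
      ext s'
      simp [mul_comm, mul_left_comm]
    rw [hMtW, hr] at this
    rw [mul_sub, sub_smul, ← add_sub_assoc, this, add_sub_cancel_right]
  have hWV : W = V + (t * (ρ - c ⬝ᵥ W)) • x := by
    have := congrArg (M⁻¹ *ᵥ ·) hMW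
    simpa only [Matrix.mulVec_mulVec, Matrix.nonsing_inv_mul _ (isUnit_iff_ne_zero.2 hdet),
      Matrix.one_mulVec, Matrix.mulVec_add, Matrix.mulVec_smul] using this
  have hcW := congrArg (c ⬝ᵥ ·) hWV
  have hdW := congrArg (d0 ⬝ᵥ ·) hWV
  simp only [dotProduct_add, dotProduct_smul, smul_eq_mul] at hcW hdW
  change (1 + c ⬝ᵥ x * t) * (d0 ⬝ᵥ W - d0 ⬝ᵥ V) = (ρ - c ⬝ᵥ V) * (d0 ⬝ᵥ x) * t
  rw [hdW]
  linear_combination (t * (d0 ⬝ᵥ x)) * (-hcW)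

/-- The derivative of a function given along a line in linear fractional form. -/
lemma fderiv_eq_of_linear_fractional {E : Type*} [NormedAddCommGroup E] [NormedSpace ℝ E]
    {J : E → ℝ} {x v : E} {k m : ℝ} (hJ : DifferentiableAt ℝ J x)
    (h : ∀ᶠ t in 𝓝 (0 : ℝ), (1 + k * t) * (J (x + t • v) - J x) = m * t) :
    fderiv ℝ J x v = m := by
  have hline : HasDerivAt (fun t : ℝ => x + t • v) v 0 := by
    simpa using ((hasDerivAt_id (0 : ℝ)).smul_const v).const_add x
  have hJ' : HasFDerivAt J (fderiv ℝ J x) (x + (0 : ℝ) • v) := by simpa using hJ.hasFDerivAt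
  have h1 := hJ'.comp_hasDerivAt (0 : ℝ) hline
  have h2 : HasDerivAt (fun t : ℝ => 1 + k * t) k 0 := by
    simpa using ((hasDerivAt_id (0 : ℝ)).const_mul k).const_add 1
  have h3 := h2.mul (h1.sub_const (J x))
  have h4 : HasDerivAt (fun t : ℝ => m * t) m 0 := by
    simpa using (hasDerivAt_id (0 : ℝ)).const_mul m
  simpa using h3.unique (h4.congr_of_eventuallyEq h)

lemma IsPolicy.add_smul_sub {S A : Type*} [Fintype A] {p q : S → A → ℝ} (hp : IsPolicy p)
    (hq : IsPolicy q) {u : ℝ} (hu : u ∈ Set.Icc (0 : ℝ) 1) : IsPolicy (p + u • (q - p)) := by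
  refine fun s => ⟨fun a => ?_, ?_⟩
  · have h1 := mul_nonneg (sub_nonneg.2 hu.2) ((hp s).1 a)
    have h2 := mul_nonneg hu.1 ((hq s).1 a)
    simp only [Pi.add_apply, Pi.smul_apply, Pi.sub_apply, smul_eq_mul]
    linarith
  · simp [Finset.sum_add_distrib, ← Finset.mul_sum, (hp s).2, (hq s).2]

lemma IsPolicy.isTangent_sub {S A : Type*} [Fintype A] {p q : S → A → ℝ} (hp : IsPolicy p)
    (hq : IsPolicy q) : IsTangent (q - p) := fun s => by
  simp [(hp s).2, (hq s).2]

lemma IsTangent.smul_add_smul {S A : Type*} [Fintype A] {v w : S → A → ℝ} (hv : IsTangent v)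
    (hw : IsTangent w) (t u : ℝ) : IsTangent (t • v + u • w) := fun s => by
  simp [Finset.sum_add_distrib, ← Finset.mul_sum, hv s, hw s]

lemma eventually_add_mem_PiPlus {X S A : Type*} [TopologicalSpace X] [Finite S] [Fintype A]
    {U : Set (S → A → ℝ)} (hU : IsOpen U) {π : S → A → ℝ} (hπ : π ∈ U ∩ PiPlus)
    {c : X → S → A → ℝ} {x : X} (hc : ContinuousAt c x) (hcx : c x = 0)
    (hct : ∀ y, IsTangent (c y)) : ∀ᶠ y in 𝓝 x, π + c y ∈ U ∩ PiPlus := by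
  have hc' : ContinuousAt (fun y => π + c y) x := continuousAt_const.add hc
  have hpos : ∀ᶠ y in 𝓝 x, ∀ s a, 0 < (π + c y) s a := by
    refine eventually_all.2 fun s => eventually_all.2 fun a => ?_
    have : ContinuousAt (fun y => (π + c y) s a) x :=
      ((continuous_apply_apply s a).continuousAt).comp hc'
    exact this.eventually (lt_mem_nhds (by simpa [hcx] using hπ.2.2 s a))
  filter_upwards [hpos, hc'.eventually (hU.mem_nhds (by simpa [hcx] using hπ.1))] with y hy hyU
  refine ⟨hyU, fun s => ⟨fun a => (hy s a).le, ?_⟩, hy⟩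
  simp [Finset.sum_add_distrib, (hπ.2.1 s).2, hct y s]

lemma exists_TangGradNeZero_Jval (hT : IsTransModel T) (hγ0 : 0 ≤ γ) (hγ1 : γ < 1)
    {U : Set (S → A → ℝ)} (hU : IsOpen U) (hne : (U ∩ PiPlus).Nonempty)
    (hnc : ∃ π ∈ PiPlus (S := S) (A := A), ∃ π' ∈ PiPlus, Jval T R d0 γ π ≠ Jval T R d0 γ π') :
    ∃ π ∈ U ∩ PiPlus, TangGradNeZero (Jval T R d0 γ) π := by
  by_contra! hzero
  obtain ⟨p, hp⟩ := hne
  have hconst : ∀ π, IsPolicy π → Jval T R d0 γ π = Jval T R d0 γ p := by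
    intro π hπ
    have hw := hp.2.1.isTangent_sub hπ
    have hcont : Continuous fun u : ℝ => u • (π - p) := by fun_prop
    have hev := eventually_add_mem_PiPlus hU hp (hcont.continuousAt (x := 0)) (by simp)
      (fun u => by simpa using hw.smul_add_smul hw u 0)
    have hloc : ∀ᶠ u in 𝓝 (0 : ℝ),
        HasDerivAt (fun u : ℝ => Jval T R d0 γ (p + u • (π - p))) 0 u := by
      filter_upwards [hev] with u hu
      have hline : HasDerivAt (fun t : ℝ => p + t • (π - p)) (π - p) u := by
        simpa using ((hasDerivAt_id u).smul_const (π - p)).const_add p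
      have hJ := (analyticAt_Jval (R := R) (d0 := d0) hT hγ0 hγ1
        hu.2.1).differentiableAt.hasFDerivAt.comp_hasDerivAt u hline
      have h0 : fderiv ℝ (Jval T R d0 γ) (p + u • (π - p)) (π - p) = 0 := by
        by_contra h
        exact hzero _ hu ⟨_, hw, h⟩
      rw [h0] at hJ
      exact hJ
    obtain ⟨r, hr, hball⟩ := Metric.eventually_nhds_iff_ball.1 hloc
    have heq : (fun u : ℝ => Jval T R d0 γ (p + u • (π - p))) =ᶠ[𝓝 0]
        fun _ => Jval T R d0 γ p := by
      filter_upwards [Metric.ball_mem_nhds (0 : ℝ) hr] with u hu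
      simpa using Metric.isOpen_ball.is_const_of_deriv_eq_zero
        (convex_ball (0 : ℝ) r).isPreconnected
        (fun u hu => (hball u hu).differentiableAt.differentiableWithinAt)
        (fun u hu => (hball u hu).deriv) hu (Metric.mem_ball_self hr)
    have han : AnalyticOnNhd ℝ (fun u : ℝ => Jval T R d0 γ (p + u • (π - p))) (Set.Icc 0 1) :=
      fun u hu => AnalyticAt.fun_comp (f := fun u : ℝ => p + u • (π - p))
        (analyticAt_Jval hT hγ0 hγ1 (hp.2.1.add_smul_sub hπ hu)) (by fun_prop)
    simpa using han.eqOn_of_preconnected_of_eventuallyEq analyticOnNhd_const isPreconnected_Icc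
      (Set.left_mem_Icc.2 zero_le_one) heq (Set.right_mem_Icc.2 zero_le_one)
  obtain ⟨π, hπ, π', hπ', hne⟩ := hnc
  exact hne ((hconst π hπ.1).trans (hconst π' hπ'.1).symm)

lemma TangGradNeZero.eventually {S A : Type*} [Fintype S] [Fintype A] {J : (S → A → ℝ) → ℝ}
    {π : S → A → ℝ} (h : TangGradNeZero J π) (hJ : AnalyticAt ℝ J π) :
    ∀ᶠ p in 𝓝 π, TangGradNeZero J p := by
  obtain ⟨v, hv, hne⟩ := h
  have hc : ContinuousAt (fun p => fderiv ℝ J p v) π :=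
    hJ.fderiv.continuousAt.clm_apply continuousAt_const
  exact (hc.eventually_ne hne).mono fun p hp => ⟨v, hv, hp⟩

lemma TangGradNeZero.exists_single {S A : Type*} [Fintype S] [Fintype A] [DecidableEq S]
    {J : (S → A → ℝ) → ℝ} {π : S → A → ℝ} (h : TangGradNeZero J π) :
    ∃ s v, IsTangent v ∧ (∀ s', s' ≠ s → v s' = 0) ∧ fderiv ℝ J π v ≠ 0 := by
  obtain ⟨v, hv, hne⟩ := h
  rw [← Finset.univ_sum_single v, map_sum] at hne
  obtain ⟨s, -, hs⟩ := Finset.exists_ne_zero_of_sum_ne_zero hne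
  refine ⟨s, Pi.single s (v s), fun s' => ?_, fun s' hs' => Pi.single_eq_of_ne hs' _, hs⟩
  rcases eq_or_ne s' s with rfl | hs'
  · simpa using hv s'
  · simp [Pi.single_eq_of_ne hs']

/-- If `Y` is the linear fractional function of `X` determined by `m₁ Y - m₂ X + κ X Y = 0` on a
preconnected set where `X` vanishes somewhere, with `m₁ m₂ > 0`, then `X` and `Y` induce the same
order. -/
lemma le_iff_le_of_linear_fractional {E : Type*} [TopologicalSpace E] {X Y : E → ℝ} {s : Set E}
    {m₁ m₂ κ : ℝ} (hs : IsPreconnected s) (hX : ContinuousOn X s) {x₀ : E} (hx₀ : x₀ ∈ s)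
    (hX₀ : X x₀ = 0) (hm : 0 < m₁ * m₂) (h : ∀ x ∈ s, m₁ * Y x - m₂ * X x + κ * X x * Y x = 0)
    {x y : E} (hx : x ∈ s) (hy : y ∈ s) : X x ≤ X y ↔ Y x ≤ Y y := by
  have hm₁ : m₁ ≠ 0 := left_ne_zero_of_mul hm.ne'
  have hm₂ : m₂ ≠ 0 := right_ne_zero_of_mul hm.ne'
  have hpos : ∀ z ∈ s, 0 < m₁ * (m₁ + κ * X z) := by
    intro z hz
    by_contra! hle
    have hcont : ContinuousOn (fun z => m₁ * (m₁ + κ * X z)) s := by fun_prop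
    obtain ⟨z', hz', h0⟩ := hs.intermediate_value hz hx₀ hcont
      (show (0 : ℝ) ∈ Set.Icc _ _ from ⟨hle, by simp [hX₀, mul_self_nonneg]⟩)
    have h1 : m₁ + κ * X z' = 0 := (mul_eq_zero.1 h0).resolve_left hm₁
    have h2 : m₂ * X z' = 0 := by linear_combination Y z' * h1 - h z' hz'
    have h3 : X z' = 0 := (mul_eq_zero.1 h2).resolve_left hm₂
    exact hm₁ (by simpa [h3] using h1)
  have hD := mul_pos (hpos x hx) (hpos y hy)
  have hkey : (Y y - Y x) * ((m₁ * (m₁ + κ * X x)) * (m₁ * (m₁ + κ * X y))) =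
      m₁ ^ 2 * (m₁ * m₂) * (X y - X x) := by
    linear_combination m₁ ^ 2 * ((m₁ + κ * X x) * h y hy - (m₁ + κ * X y) * h x hx)
  have hC : 0 < m₁ ^ 2 * (m₁ * m₂) := by positivity
  rw [← sub_nonneg, ← sub_nonneg (b := Y x), ← mul_nonneg_iff_of_pos_left hC, ← hkey,
    mul_nonneg_iff_of_pos_right hD]

/-- Where the tangential gradients are positively proportional, each of two values is locally, hence
globally, the same linear fractional function of the other. -/
lemma exists_linear_fractional_relation {T₁ T₂ : S → A → S → ℝ} (hT₁ : IsTransModel T₁)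
    (hT₂ : IsTransModel T₂) (hγ0 : 0 ≤ γ) (hγ1 : γ < 1) {U : Set (S → A → ℝ)} (hU : IsOpen U)
    {π₀ : S → A → ℝ} (hπ₀ : π₀ ∈ U ∩ PiPlus) (hgrad : TangGradNeZero (Jval T₁ R d0 γ) π₀)
    (hprop : ∀ π ∈ U ∩ PiPlus, ∃ lam : ℝ, 0 < lam ∧ ∀ v : S → A → ℝ, IsTangent v →
      fderiv ℝ (Jval T₂ R d0 γ) π v = lam * fderiv ℝ (Jval T₁ R d0 γ) π v) :
    ∃ m₁ m₂ κ : ℝ, 0 < m₁ * m₂ ∧ ∀ π, IsPolicy π →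
      m₁ * (Jval T₂ R d0 γ π - Jval T₂ R d0 γ π₀) - m₂ * (Jval T₁ R d0 γ π - Jval T₁ R d0 γ π₀) +
        κ * (Jval T₁ R d0 γ π - Jval T₁ R d0 γ π₀) *
          (Jval T₂ R d0 γ π - Jval T₂ R d0 γ π₀) = 0 := by
  have han₁ : ∀ π, IsPolicy π → AnalyticAt ℝ (Jval T₁ R d0 γ) π :=
    fun π hπ => analyticAt_Jval hT₁ hγ0 hγ1 hπ
  have han₂ : ∀ π, IsPolicy π → AnalyticAt ℝ (Jval T₂ R d0 γ) π :=
    fun π hπ => analyticAt_Jval hT₂ hγ0 hγ1 hπ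
  have hdet₁ : ∀ π, IsPolicy π → (1 - γ • Pmat T₁ π).det ≠ 0 :=
    fun π hπ => det_one_sub_smul_Pmat_ne_zero hT₁ hγ0 hγ1 hπ
  have hdet₂ : ∀ π, IsPolicy π → (1 - γ • Pmat T₂ π).det ≠ 0 :=
    fun π hπ => det_one_sub_smul_Pmat_ne_zero hT₂ hγ0 hγ1 hπ
  obtain ⟨s, v, hv, hvs, hne⟩ := hgrad.exists_single
  obtain ⟨k₁, m₁, hk₁⟩ :=
    exists_linear_fractional_Jval (R := R) (d0 := d0) hvs (hdet₁ _ hπ₀.2.1)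
  obtain ⟨k₂, m₂, hk₂⟩ :=
    exists_linear_fractional_Jval (R := R) (d0 := d0) hvs (hdet₂ _ hπ₀.2.1)
  have hcv : Continuous fun t : ℝ => t • v := by fun_prop
  have hevv := eventually_add_mem_PiPlus hU hπ₀ (hcv.continuousAt (x := 0)) (by simp)
    (fun u => by simpa using hv.smul_add_smul hv u 0)
  have hm₁ : fderiv ℝ (Jval T₁ R d0 γ) π₀ v = m₁ :=
    fderiv_eq_of_linear_fractional (han₁ _ hπ₀.2.1).differentiableAt
      (hevv.mono fun t ht => hk₁ t (hdet₁ _ ht.2.1))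
  have hm₂ : fderiv ℝ (Jval T₂ R d0 γ) π₀ v = m₂ :=
    fderiv_eq_of_linear_fractional (han₂ _ hπ₀.2.1).differentiableAt
      (hevv.mono fun t ht => hk₂ t (hdet₂ _ ht.2.1))
  rw [hm₁] at hne
  obtain ⟨lam, hlam, hl⟩ := hprop π₀ hπ₀
  have hl' := hl v hv
  rw [hm₁, hm₂] at hl'
  refine ⟨m₁, m₂, k₂ - k₁, ?_, fun π hπ => ?_⟩
  · rw [hl', mul_left_comm]
    exact mul_pos hlam (mul_self_pos.2 hne)
  set w := π - π₀ with hw_def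
  have hw : IsTangent w := hπ₀.2.1.isTangent_sub hπ
  let L : ℝ × ℝ →L[ℝ] (S → A → ℝ) := (ContinuousLinearMap.fst ℝ ℝ ℝ).smulRight v +
    (ContinuousLinearMap.snd ℝ ℝ ℝ).smulRight w
  have hLapply : ∀ p, L p = p.1 • v + p.2 • w := fun p => rfl
  have hLt : ∀ p, IsTangent (L p) := fun p => hv.smul_add_smul hw p.1 p.2
  let F : ℝ × ℝ → ℝ := fun z => Jval T₁ R d0 γ (π₀ + L z)
  let G : ℝ × ℝ → ℝ := fun z => Jval T₂ R d0 γ (π₀ + L z)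
  have hcan : ∀ z, AnalyticAt ℝ (fun z => π₀ + L z) z := fun z =>
    analyticAt_const.add (L.analyticAt z)
  have hFan : ∀ z, IsPolicy (π₀ + L z) → AnalyticAt ℝ F z := fun z hz =>
    AnalyticAt.fun_comp (f := fun z => π₀ + L z) (han₁ _ hz) (hcan z)
  have hGan : ∀ z, IsPolicy (π₀ + L z) → AnalyticAt ℝ G z := fun z hz =>
    AnalyticAt.fun_comp (f := fun z => π₀ + L z) (han₂ _ hz) (hcan z)
  have hFd : ∀ z, IsPolicy (π₀ + L z) →
      HasFDerivAt F ((fderiv ℝ (Jval T₁ R d0 γ) (π₀ + L z)).comp L) z := fun z hz =>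
    HasFDerivAt.comp (f := fun z => π₀ + L z) z (han₁ _ hz).differentiableAt.hasFDerivAt
      (L.hasFDerivAt.const_add π₀)
  have hGd : ∀ z, IsPolicy (π₀ + L z) →
      HasFDerivAt G ((fderiv ℝ (Jval T₂ R d0 γ) (π₀ + L z)).comp L) z := fun z hz =>
    HasFDerivAt.comp (f := fun z => π₀ + L z) z (han₂ _ hz).differentiableAt.hasFDerivAt
      (L.hasFDerivAt.const_add π₀)
  let h : ℝ × ℝ → ℝ := fun z => m₁ * (G z - Jval T₂ R d0 γ π₀) - m₂ * (F z - Jval T₁ R d0 γ π₀) +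
    (k₂ - k₁) * (F z - Jval T₁ R d0 γ π₀) * (G z - Jval T₂ R d0 γ π₀)
  have hhan : ∀ z, IsPolicy (π₀ + L z) → AnalyticAt ℝ h z := by
    intro z hz
    have h1 := hFan z hz
    have h2 := hGan z hz
    fun_prop
  have hev : ∀ᶠ z in 𝓝 0, π₀ + L z ∈ U ∩ PiPlus :=
    eventually_add_mem_PiPlus hU hπ₀ L.continuous.continuousAt (map_zero L) hLt
  have hp0 : IsPolicy (π₀ + L 0) := by simpa using hπ₀.2.1
  have hh : ∀ᶠ z in 𝓝 0, h z = 0 := by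
    refine eventually_eq_zero_of_ker_fderiv_le (F := F) (hFan 0 hp0).contDiffAt
      (hev.mono fun z hz => (hhan z hz.2.1).differentiableAt) ?_ ?_ ?_
    · rw [(hFd 0 hp0).fderiv]
      simpa [hLapply, hm₁] using hne
    · filter_upwards [hev] with z hz p hp
      obtain ⟨lam, -, hlam⟩ := hprop _ hz
      have hF := hFd z hz.2.1
      have hG := hGd z hz.2.1
      have hGp : fderiv ℝ G z p = 0 := by
        rw [hG.fderiv, ContinuousLinearMap.comp_apply, hlam _ (hLt p)]
        rw [hF.fderiv, ContinuousLinearMap.comp_apply] at hp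
        rw [hp, mul_zero]
      have hF' := hF.differentiableAt.hasFDerivAt.sub_const (Jval T₁ R d0 γ π₀)
      have hG' := hG.differentiableAt.hasFDerivAt.sub_const (Jval T₂ R d0 γ π₀)
      have hd : HasFDerivAt h _ z :=
        ((hG'.const_mul m₁).sub (hF'.const_mul m₂)).add ((hF'.const_mul (k₂ - k₁)).mul hG')
      rw [hd.fderiv]
      simp [hp, hGp]
    · filter_upwards [hevv] with t ht
      have e₁ := hk₁ t (hdet₁ _ ht.2.1)
      have e₂ := hk₂ t (hdet₂ _ ht.2.1)
      have hL0 : L (t, 0) = t • v := by simp [hLapply]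
      simp only [h, F, G, hL0]
      set X := Jval T₁ R d0 γ (π₀ + t • v) - Jval T₁ R d0 γ π₀
      set Y := Jval T₂ R d0 γ (π₀ + t • v) - Jval T₂ R d0 γ π₀
      rcases eq_or_ne t 0 with rfl | ht0
      · simp [X, Y]
      · refine mul_left_cancel₀ ht0 ?_
        linear_combination X * e₂ - Y * e₁
  have hseg : ∀ u ∈ Set.Icc (0 : ℝ) 1, IsPolicy (π₀ + L (0, u)) := by
    intro u hu
    simpa [hLapply] using hπ₀.2.1.add_smul_sub hπ hu
  have hpre : IsPreconnected ((fun u : ℝ => ((0, u) : ℝ × ℝ)) '' Set.Icc 0 1) :=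
    isPreconnected_Icc.image _ (by fun_prop)
  have hmem : ∀ u ∈ Set.Icc (0 : ℝ) 1,
      ((0, u) : ℝ × ℝ) ∈ (fun u : ℝ => ((0, u) : ℝ × ℝ)) '' Set.Icc 0 1 :=
    fun u hu => Set.mem_image_of_mem _ hu
  have hhon : AnalyticOnNhd ℝ h ((fun u : ℝ => ((0, u) : ℝ × ℝ)) '' Set.Icc 0 1) := by
    rintro _ ⟨u, hu, rfl⟩
    exact hhan _ (hseg u hu)
  have hfin := hhon.eqOn_of_preconnected_of_eventuallyEq
    analyticOnNhd_const hpre (hmem 0 (by simp)) hh (hmem 1 (by simp))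
  simpa [h, F, G, hLapply, hw_def] using hfin

end MarkovDecisionProcess

/-- **Global equivalence lemma**: if `J_1, J_2` are non-constant on `Π⁺` and
their tangential gradients are positively proportional at every point of a
nonempty subset `Pt ⊆ Ps` open in `Π⁺` where both are nonzero, then `J_1` and
`J_2` induce the same ordering on `Ps`. -/
theorem stmt7 {S A : Type*} [Fintype S] [Fintype A] [DecidableEq S] [Nonempty S]
    (hA : 1 < Fintype.card A)
    (d0 : S → ℝ) (hd0 : IsDist d0) (R : S → A → ℝ)
    (γ : ℝ) (hγ0 : 0 ≤ γ) (hγ1 : γ < 1)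
    (T₁ T₂ : S → A → S → ℝ) (hT₁ : IsTransModel T₁) (hT₂ : IsTransModel T₂)
    (Ps Pt : Set (S → A → ℝ)) (hPs : ∀ p ∈ Ps, IsPolicy p)
    (hsub : Pt ⊆ Ps) (hne : Pt.Nonempty)
    -- `Pt` is open in the subspace topology of `Π⁺`
    (hopen : ∃ U : Set (S → A → ℝ), IsOpen U ∧ Pt = U ∩ PiPlus)
    -- `J_1` is non-constant on `Π⁺`
    (hnc1 : ∃ π ∈ PiPlus (S := S) (A := A), ∃ π' ∈ PiPlus,
      Jval T₁ R d0 γ π ≠ Jval T₁ R d0 γ π')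
    -- `J_2` is non-constant on `Π⁺`
    (hnc2 : ∃ π ∈ PiPlus (S := S) (A := A), ∃ π' ∈ PiPlus,
      Jval T₂ R d0 γ π ≠ Jval T₂ R d0 γ π')
    -- positively proportional tangential gradients wherever both are nonzero on `Pt`
    (hprop : ∀ π ∈ Pt,
      TangGradNeZero (Jval T₁ R d0 γ) π → TangGradNeZero (Jval T₂ R d0 γ) π →
      ∃ lam : ℝ, 0 < lam ∧ ∀ v : S → A → ℝ, IsTangent v →
        fderiv ℝ (Jval T₂ R d0 γ) π v = lam * fderiv ℝ (Jval T₁ R d0 γ) π v) :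
    ∀ π ∈ Ps, ∀ π' ∈ Ps,
      (Jval T₁ R d0 γ π' ≤ Jval T₁ R d0 γ π ↔
        Jval T₂ R d0 γ π' ≤ Jval T₂ R d0 γ π) := by
  obtain ⟨U, hU, rfl⟩ := hopen
  obtain ⟨π₁, hπ₁, hg₁⟩ := exists_TangGradNeZero_Jval hT₁ hγ0 hγ1 hU hne hnc1
  obtain ⟨W₁, hW₁, hW₁o, hπW₁⟩ :=
    eventually_nhds_iff.1 (hg₁.eventually (analyticAt_Jval hT₁ hγ0 hγ1 hπ₁.2.1))
  obtain ⟨π₀, hπ₀, hg₂⟩ := exists_TangGradNeZero_Jval hT₂ hγ0 hγ1 (hU.inter hW₁o)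
    ⟨π₁, ⟨hπ₁.1, hπW₁⟩, hπ₁.2⟩ hnc2
  obtain ⟨W₂, hW₂, hW₂o, hπW₂⟩ :=
    eventually_nhds_iff.1 (hg₂.eventually (analyticAt_Jval hT₂ hγ0 hγ1 hπ₀.2.1))
  obtain ⟨m₁, m₂, κ, hm, hrel⟩ := exists_linear_fractional_relation hT₁ hT₂ hγ0 hγ1
    ((hU.inter hW₁o).inter hW₂o) ⟨⟨hπ₀.1, hπW₂⟩, hπ₀.2⟩ (hW₁ _ hπ₀.1.2)
    (fun π hπ => hprop π ⟨hπ.1.1.1, hπ.2⟩ (hW₁ _ hπ.1.1.2) (hW₂ _ hπ.1.2))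
  have hconv : Convex ℝ {π : S → A → ℝ | IsPolicy π} := by
    refine convex_iff_forall_pos.2 fun p hp q hq a b ha hb hab => ?_
    have := hp.add_smul_sub hq (u := b) ⟨hb.le, by linarith⟩
    rw [← eq_sub_iff_add_eq] at hab
    have heq : a • p + b • q = p + b • (q - p) := by rw [hab]; module
    exact heq ▸ this
  intro π hπ π' hπ'
  simpa using le_iff_le_of_linear_fractional
    (X := fun p => Jval T₁ R d0 γ p - Jval T₁ R d0 γ π₀)
    (Y := fun p => Jval T₂ R d0 γ p - Jval T₂ R d0 γ π₀) hconv.isPreconnected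
    (fun p hp => ((analyticAt_Jval hT₁ hγ0 hγ1 hp).continuousAt.sub
      continuousAt_const).continuousWithinAt)
    hπ₀.2.1 (sub_self _) hm hrel (hPs π' hπ') (hPs π hπ)
end
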